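/- If 0 < θ < 1, 0 < ρ < 1, and either θ + ρ > 1, or θ + ρ = 1 and t·r(t)·q(t) → 0 as t → ∞, then I(t)/(t·r(t)·q(t)·B(1−ρ, 1−θ)) → 1 and I(t) → 0 as t → ∞, where B(·,·) is Euler's Beta function; consequently P_t ∼ t·r(t)·q(t)·B(1−ρ, 1−θ) as t → ∞. -/

import Mathlib

section

open Filter MeasureTheory Set
open scoped Topology

theorem forall_ge_of_forall_half {p : ℝ → Prop} {T : ℝ} (hT : 0 < T)
    (base : ∀ t ∈ Icc T (2 * T), p t) (step : ∀ t, 2 * T ≤ t → p (t / 2) → p t) :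
    ∀ t, T ≤ t → p t := by
  have key : ∀ n : ℕ, ∀ t, T ≤ t → t ≤ 2 ^ n * (2 * T) → p t := by
    intro n
    induction n with
    | zero => exact fun t h₁ h₂ => base t ⟨h₁, by simpa using h₂⟩
    | succ n ih =>
      intro t h₁ h₂
      rcases le_total t (2 * T) with h | h
      · exact base t ⟨h₁, h⟩
      · refine step t h (ih _ (by linarith) ?_)
        rw [pow_succ] at h₂
        linarith
  intro t ht
  obtain ⟨n, hn⟩ := pow_unbounded_of_one_lt (t / (2 * T)) (one_lt_two : (1 : ℝ) < 2)
  refine key n t ht ?_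
  rw [div_lt_iff₀ (by positivity)] at hn
  exact hn.le

theorem tendsto_zero_of_half_le {g : ℝ → ℝ} {κ M T : ℝ} (hT : 0 < T) (hκ₀ : 0 ≤ κ) (hκ₁ : κ < 1)
    (hg : ∀ t > 0, 0 ≤ g t) (base : ∀ t ∈ Icc T (2 * T), g t ≤ M)
    (step : ∀ t, 2 * T ≤ t → g t ≤ κ * g (t / 2)) :
    Tendsto g atTop (𝓝 0) := by
  have hbdd : ∀ t, T ≤ t → g t ≤ M := by
    refine forall_ge_of_forall_half hT base fun t ht h => ?_
    have h0 := hg (t / 2) (by linarith)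
    nlinarith [step t ht]
  have hdecay : ∀ n : ℕ, ∀ t, 2 ^ n * T ≤ t → g t ≤ κ ^ n * M := by
    intro n
    induction n with
    | zero => intro t ht; simpa using hbdd t (by simpa using ht)
    | succ n ih =>
      intro t ht
      rw [pow_succ] at ht
      have h1 : (1 : ℝ) ≤ 2 ^ n := one_le_pow₀ one_le_two
      have h2 := ih (t / 2) (by linarith)
      calc g t ≤ κ * g (t / 2) := step t (by nlinarith)
        _ ≤ κ * (κ ^ n * M) := by gcongr
        _ = κ ^ (n + 1) * M := by ring
  have hlim : Tendsto (fun n : ℕ => κ ^ n * M) atTop (𝓝 0) := by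
    simpa using (tendsto_pow_atTop_nhds_zero_of_lt_one hκ₀ hκ₁).mul_const M
  rw [Metric.tendsto_atTop]
  intro ε hε
  obtain ⟨n, hn⟩ := (hlim.eventually (gt_mem_nhds hε)).exists
  refine ⟨2 ^ n * T, fun t ht => ?_⟩
  have htpos : 0 < t := lt_of_lt_of_le (by positivity) ht
  rw [Real.dist_eq, sub_zero, abs_of_nonneg (hg t htpos)]
  exact (hdecay n t ht).trans_lt hn

theorem exists_integral_le_mul {q : ℝ → ℝ} {ρ : ℝ} (hρ : ρ < 1)
    (hqpos : ∀ t > 0, 0 < q t) (hqanti : AntitoneOn q (Ioi 0))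
    (hqint : ∀ t > 0, IntegrableOn q (Ioc 0 t))
    (hqrv : ∀ c > 0, Tendsto (fun t => q (c * t) / q t) atTop (𝓝 (c ^ (-ρ)))) :
    ∃ C T : ℝ, 0 ≤ C ∧ 0 < T ∧ ∀ t, T ≤ t → ∫ u in (0 : ℝ)..t, q u ≤ C * (t * q t) := by
  have hlt : ((1 / 2 : ℝ)) ^ (-ρ) < 2 := by
    rw [one_div, Real.inv_rpow zero_le_two, Real.rpow_neg zero_le_two, inv_inv]
    simpa using Real.rpow_lt_rpow_of_exponent_lt (one_lt_two : (1 : ℝ) < 2) hρ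
  obtain ⟨a, ha₁, ha₂⟩ := exists_between hlt
  have ha₀ : 0 < a := lt_trans (by positivity) ha₁
  obtain ⟨T, hT, hqT⟩ : ∃ T > 0, ∀ t, T ≤ t → q (t / 2) ≤ a * q t := by
    obtain ⟨T, hT⟩ := eventually_atTop.1
      (((hqrv (1 / 2) (by norm_num)).eventually (gt_mem_nhds ha₁)))
    refine ⟨max T 1, by positivity, fun t ht => ?_⟩
    have htpos : 0 < t := by linarith [le_max_right T 1]
    have := hT t ((le_max_left _ _).trans ht)
    rw [div_lt_iff₀ (hqpos t htpos)] at this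
    rw [show t / 2 = 1 / 2 * t by ring]
    exact this.le
  have hii : ∀ t > 0, IntervalIntegrable q volume 0 t := fun t ht =>
    (intervalIntegrable_iff_integrableOn_Ioc_of_le ht.le).2 (hqint t ht)
  have hnn : ∀ t > 0, 0 ≤ ∫ u in (0 : ℝ)..t, q u := fun t ht => by
    rw [intervalIntegral.integral_of_le ht.le]
    exact setIntegral_nonneg measurableSet_Ioc fun u hu => (hqpos u hu.1).le
  have hD : 0 < T * q (2 * T) := mul_pos hT (hqpos _ (by positivity))
  have hC₁ : 0 < 1 - a / 2 := by linarith
  refine ⟨max ((∫ u in (0 : ℝ)..(2 * T), q u) / (T * q (2 * T))) (a / 2 / (1 - a / 2)), T,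
    le_max_of_le_right (by positivity), hT, ?_⟩
  set C := max ((∫ u in (0 : ℝ)..(2 * T), q u) / (T * q (2 * T))) (a / 2 / (1 - a / 2)) with hC
  have hCa : a / 2 ≤ C * (1 - a / 2) := (div_le_iff₀ hC₁).1 (le_max_right _ _)
  have hCb : (∫ u in (0 : ℝ)..(2 * T), q u) ≤ C * (T * q (2 * T)) :=
    (div_le_iff₀ hD).1 (le_max_left _ _)
  have hC₀ : 0 ≤ C := le_max_of_le_right (by positivity)
  refine forall_ge_of_forall_half hT (fun t ht => ?_) (fun t ht h => ?_)
  · have htpos : 0 < t := hT.trans_le ht.1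
    have h₁ : ∫ u in (0 : ℝ)..t, q u ≤ ∫ u in (0 : ℝ)..(2 * T), q u := by
      refine intervalIntegral.integral_mono_interval le_rfl htpos.le ht.2 ?_
        (hii _ (by positivity))
      exact (ae_restrict_iff' measurableSet_Ioc).2 (ae_of_all _ fun u hu => (hqpos u hu.1).le)
    refine h₁.trans (hCb.trans ?_)
    gcongr
    · exact (hqpos _ (by positivity)).le
    · exact ht.1
    · exact hqanti htpos (show (0 : ℝ) < 2 * T by positivity) ht.2
  · have htpos : 0 < t := by linarith
    have hhalf : 0 < t / 2 := by positivity
    have hright : IntervalIntegrable q volume (t / 2) t :=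
      (hii t htpos).mono_set (by
        rw [uIcc_of_le htpos.le, uIcc_of_le (by linarith)]; exact Icc_subset_Icc_left hhalf.le)
    have h₂ : ∫ u in (t / 2)..t, q u ≤ t / 2 * q (t / 2) := by
      calc ∫ u in (t / 2)..t, q u ≤ ∫ _u in (t / 2)..t, q (t / 2) :=
            intervalIntegral.integral_mono_on (by linarith) hright (by simp)
              fun u hu => hqanti hhalf (hhalf.trans_le hu.1) hu.1
        _ = t / 2 * q (t / 2) := by rw [intervalIntegral.integral_const, smul_eq_mul]; ring
    rw [← intervalIntegral.integral_add_adjacent_intervals (hii _ hhalf) hright]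
    have h₃ := hqT t (by linarith)
    have hq := hqpos t htpos
    have h₄ : t / 2 * q (t / 2) ≤ t / 2 * (a * q t) := by gcongr
    have h₅ : C * (t / 2 * q (t / 2)) ≤ C * (t / 2 * (a * q t)) := by gcongr
    have h₆ : a / 2 * (t * q t) ≤ C * (1 - a / 2) * (t * q t) := by gcongr
    linarith

theorem intervalIntegrable_mul_comp_half {r q : ℝ → ℝ} {t : ℝ} (ht : 0 < t)
    (hrpos : ∀ t > 0, 0 < r t) (hranti : AntitoneOn r (Ioi 0))
    (hqint : ∀ t > 0, IntegrableOn q (Ioc 0 t)) :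
    IntervalIntegrable (fun x => r ((1 - x) * t) * q (x * t)) volume 0 (1 / 2) := by
  have h₁ : IntervalIntegrable (fun x => q (x * t)) volume 0 (1 / 2) := by
    have := ((intervalIntegrable_iff_integrableOn_Ioc_of_le (by positivity)).2
      (hqint (t / 2) (by positivity))).comp_mul_right (c := t)
    simpa [div_div_cancel_left' ht.ne', zero_div, div_right_comm, div_self ht.ne'] using this
  rw [intervalIntegrable_iff_integrableOn_Ioc_of_le (by norm_num)] at h₁ ⊢
  have hpos : ∀ x ∈ Ioc (0 : ℝ) (1 / 2), 0 < (1 - x) * t := fun x hx =>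
    mul_pos (by linarith [hx.2]) ht
  refine Integrable.bdd_mul (c := r (t / 2)) h₁ ?_ ?_
  · refine (aemeasurable_restrict_of_monotoneOn measurableSet_Ioc ?_).aestronglyMeasurable
    intro x hx y hy hxy
    exact hranti (hpos y hy) (hpos x hx) (by gcongr)
  · refine (ae_restrict_iff' measurableSet_Ioc).2 (ae_of_all _ fun x hx => ?_)
    rw [Real.norm_of_nonneg (hrpos _ (hpos x hx)).le]
    exact hranti (half_pos ht) (hpos x hx) (by nlinarith [hx.2])

theorem intervalIntegrable_one_sub_rpow_mul_rpow_half {θ ρ : ℝ} (hρ : ρ < 1) :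
    IntervalIntegrable (fun x : ℝ => (1 - x) ^ (-θ) * x ^ (-ρ)) volume 0 (1 / 2) := by
  refine (intervalIntegral.intervalIntegrable_rpow' (by linarith)).continuousOn_mul ?_
  refine ContinuousOn.rpow_const (by fun_prop) fun x hx => Or.inl ?_
  rw [uIcc_of_le (by norm_num)] at hx
  linarith [hx.2]

theorem tendsto_integral_half_div {r q : ℝ → ℝ} {θ ρ : ℝ} (hρ : ρ < 1)
    (hrpos : ∀ t > 0, 0 < r t) (hqpos : ∀ t > 0, 0 < q t)
    (hranti : AntitoneOn r (Ioi 0)) (hqanti : AntitoneOn q (Ioi 0))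
    (hqint : ∀ t > 0, IntegrableOn q (Ioc 0 t))
    (hrrv : ∀ c > 0, Tendsto (fun t => r (c * t) / r t) atTop (𝓝 (c ^ (-θ))))
    (hqrv : ∀ c > 0, Tendsto (fun t => q (c * t) / q t) atTop (𝓝 (c ^ (-ρ)))) :
    Tendsto (fun t => ∫ x in (0 : ℝ)..(1 / 2), r ((1 - x) * t) / r t * (q (x * t) / q t)) atTop
      (𝓝 (∫ x in (0 : ℝ)..(1 / 2), (1 - x) ^ (-θ) * x ^ (-ρ))) := by
  obtain ⟨C, T, hC, hT, hQ⟩ := exists_integral_le_mul hρ hqpos hqanti hqint hqrv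
  set F : ℝ → ℝ → ℝ := fun t x => r ((1 - x) * t) / r t * (q (x * t) / q t) with hF
  set f : ℝ → ℝ := fun x => (1 - x) ^ (-θ) * x ^ (-ρ) with hf
  have hFii : ∀ t > 0, IntervalIntegrable (F t) volume 0 (1 / 2) := fun t ht => by
    refine ((intervalIntegrable_mul_comp_half ht hrpos hranti hqint).div_const
      (r t * q t)).congr fun x _ => ?_
    simp only [hF]
    rw [div_mul_div_comm]
  have hfii : IntervalIntegrable f volume 0 (1 / 2) :=
    intervalIntegrable_one_sub_rpow_mul_rpow_half hρ
  have hsub : ∀ {g : ℝ → ℝ} {ε : ℝ}, ε ∈ Ioo (0 : ℝ) (1 / 2) →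
      IntervalIntegrable g volume 0 (1 / 2) →
      IntervalIntegrable g volume 0 ε ∧ IntervalIntegrable g volume ε (1 / 2) := by
    intro g ε hε hg
    constructor <;> refine hg.mono_set ?_
    · rw [uIcc_of_le hε.1.le, uIcc_of_le (by norm_num)]; exact Icc_subset_Icc_right hε.2.le
    · rw [uIcc_of_le hε.2.le, uIcc_of_le (by norm_num)]; exact Icc_subset_Icc_left hε.1.le
  have hmiddle : ∀ ε ∈ Ioo (0 : ℝ) (1 / 2),
      Tendsto (fun t => ∫ x in ε..(1 / 2), F t x) atTop (𝓝 (∫ x in ε..(1 / 2), f x)) := by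
    intro ε hε
    have hr₁ := (hrrv (1 / 2) (by norm_num)).eventually (gt_mem_nhds (lt_add_one _))
    have hq₁ := (hqrv ε hε.1).eventually (gt_mem_nhds (lt_add_one _))
    refine intervalIntegral.tendsto_integral_filter_of_dominated_convergence
      (fun _ => ((1 / 2) ^ (-θ) + 1) * (ε ^ (-ρ) + 1)) ?_ ?_ (by simp) ?_
    · filter_upwards [eventually_gt_atTop 0] with t ht
      exact ((hsub hε (hFii t ht)).2.def').aestronglyMeasurable
    · filter_upwards [eventually_gt_atTop 0, hr₁, hq₁] with t ht hr hq
      refine ae_of_all _ fun x hx => ?_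
      rw [uIoc_of_le hε.2.le] at hx
      have hx₀ : 0 < x := hε.1.trans hx.1
      have hx₁ : 0 < 1 - x := by linarith [hx.2]
      have hrx := hrpos _ (mul_pos hx₁ ht)
      have hqx := hqpos _ (mul_pos hx₀ ht)
      have hrt := hrpos t ht
      have hqt := hqpos t ht
      rw [Real.norm_of_nonneg (by positivity)]
      have h₁ : r ((1 - x) * t) / r t ≤ (1 / 2) ^ (-θ) + 1 := by
        refine le_trans ?_ hr.le
        gcongr
        exact hranti (show (0 : ℝ) < 1 / 2 * t by positivity) (mul_pos hx₁ ht)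
          (by nlinarith [hx.2])
      have h₂ : q (x * t) / q t ≤ ε ^ (-ρ) + 1 := by
        refine le_trans ?_ hq.le
        gcongr
        exact hqanti (mul_pos hε.1 ht) (mul_pos hx₀ ht) (by nlinarith [hx.1])
      exact mul_le_mul h₁ h₂ (by positivity) (by positivity)
    · refine ae_of_all _ fun x hx => ?_
      rw [uIoc_of_le hε.2.le] at hx
      exact (hrrv (1 - x) (by linarith [hx.2])).mul (hqrv x (hε.1.trans hx.1))
  have htail : ∀ ε ∈ Ioo (0 : ℝ) (1 / 2), ∀ᶠ t in atTop,
      |∫ x in (0 : ℝ)..ε, F t x| ≤ r (1 / 2 * t) / r t * (C * ε * (q (ε * t) / q t)) := by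
    intro ε hε
    filter_upwards [eventually_gt_atTop 0, eventually_ge_atTop (T / ε)] with t ht htT
    rw [div_le_iff₀' hε.1] at htT
    have hrt := hrpos t ht
    have hqt := hqpos t ht
    have hpos : ∀ x ∈ Ioc (0 : ℝ) ε, 0 ≤ F t x := fun x hx => by
      have hrx := hrpos _ (mul_pos (by linarith [hx.2, hε.2] : 0 < 1 - x) ht)
      have hqx := hqpos _ (mul_pos hx.1 ht)
      positivity
    have hqii : IntervalIntegrable (fun x => q (x * t)) volume 0 ε := by
      have := ((intervalIntegrable_iff_integrableOn_Ioc_of_le (mul_pos hε.1 ht).le).2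
        (hqint (ε * t) (mul_pos hε.1 ht))).comp_mul_right (c := t)
      simpa [ht.ne'] using this
    have hnn : 0 ≤ ∫ x in (0 : ℝ)..ε, F t x := by
      rw [intervalIntegral.integral_of_le hε.1.le]
      exact setIntegral_nonneg measurableSet_Ioc hpos
    rw [abs_of_nonneg hnn]
    have hQε := hQ (ε * t) htT
    calc ∫ x in (0 : ℝ)..ε, F t x
        ≤ ∫ x in (0 : ℝ)..ε, r (1 / 2 * t) / r t / q t * q (x * t) := by
          refine intervalIntegral.integral_mono_on_of_le_Ioo hε.1.le (hsub hε (hFii t ht)).1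
            (hqii.const_mul _) fun x hx => ?_
          have hqx := hqpos _ (mul_pos hx.1 ht)
          rw [div_mul_eq_mul_div (r (1 / 2 * t) / r t), mul_div_assoc (r (1 / 2 * t) / r t)]
          simp only [hF]
          gcongr
          exact hranti (show (0 : ℝ) < 1 / 2 * t by positivity)
            (mul_pos (by linarith [hx.2, hε.2] : 0 < 1 - x) ht) (by nlinarith [hx.2, hε.2])
      _ = r (1 / 2 * t) / r t / q t * (t⁻¹ * ∫ u in (0 : ℝ)..(ε * t), q u) := by
          rw [intervalIntegral.integral_const_mul, intervalIntegral.integral_comp_mul_right _ ht.ne',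
            zero_mul, smul_eq_mul]
      _ ≤ r (1 / 2 * t) / r t / q t * (t⁻¹ * (C * (ε * t * q (ε * t)))) := by
          have := hrpos (1 / 2 * t) (by positivity)
          gcongr
      _ = r (1 / 2 * t) / r t * (C * ε * (q (ε * t) / q t)) := by
          field_simp
  have hεf : Tendsto (fun ε => ∫ x in (0 : ℝ)..ε, f x) (𝓝[>] 0) (𝓝 0) := by
    have h := intervalIntegral.continuousOn_primitive_interval' hfii left_mem_uIcc 0 left_mem_uIcc
    rw [ContinuousWithinAt, intervalIntegral.integral_same, uIcc_of_le (by norm_num)] at h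
    refine h.mono_left ?_
    rw [← nhdsWithin_Ioo_eq_nhdsGT (show (0 : ℝ) < 1 / 2 by norm_num)]
    exact nhdsWithin_mono _ Ioo_subset_Icc_self
  have hεt : Tendsto (fun ε : ℝ => (1 / 2 : ℝ) ^ (-θ) * (C * ε ^ (1 - ρ))) (𝓝[>] 0) (𝓝 0) := by
    have h : ContinuousAt (fun ε : ℝ => (1 / 2 : ℝ) ^ (-θ) * (C * ε ^ (1 - ρ))) 0 :=
      continuousAt_const.mul (continuousAt_const.mul
        (Real.continuousAt_rpow_const _ _ (Or.inr (by linarith))))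
    have h' := h.tendsto
    rw [Real.zero_rpow (by linarith), mul_zero, mul_zero] at h'
    exact h'.mono_left nhdsWithin_le_nhds
  rw [Metric.tendsto_nhds]
  intro η hη
  obtain ⟨ε, ⟨hε, hε₁⟩, hε₂⟩ :=
    (((eventually_mem_set.2 (Ioo_mem_nhdsGT (show (0 : ℝ) < 1 / 2 by norm_num))).and
      (hεf.eventually (Metric.ball_mem_nhds 0 (show 0 < η / 3 by positivity)))).and
      (hεt.eventually (gt_mem_nhds (show 0 < η / 3 by positivity)))).exists
  have hlim : Tendsto (fun t => r (1 / 2 * t) / r t * (C * ε * (q (ε * t) / q t))) atTop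
      (𝓝 ((1 / 2 : ℝ) ^ (-θ) * (C * ε ^ (1 - ρ)))) := by
    have := (hrrv (1 / 2) (by norm_num)).mul ((hqrv ε hε.1).const_mul (C * ε))
    rwa [mul_assoc C, ← Real.rpow_one_add' hε.1.le (by linarith), ← sub_eq_add_neg] at this
  filter_upwards [eventually_gt_atTop 0, htail ε hε, hlim.eventually (gt_mem_nhds hε₂),
    (hmiddle ε hε).eventually (Metric.ball_mem_nhds _ (show 0 < η / 3 by positivity))]
    with t ht h₁ h₂ h₃
  obtain ⟨hFa, hFb⟩ := hsub hε (hFii t ht)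
  obtain ⟨hfa, hfb⟩ := hsub hε hfii
  rw [← intervalIntegral.integral_add_adjacent_intervals hFa hFb,
    ← intervalIntegral.integral_add_adjacent_intervals hfa hfb]
  rw [Real.dist_eq, abs_lt] at h₃
  rw [Real.dist_eq, sub_zero, abs_lt] at hε₁
  have h₄ := abs_lt.1 (h₁.trans_lt h₂)
  rw [Real.dist_eq, abs_lt]
  constructor <;> linarith [h₃.1, h₃.2, hε₁.1, hε₁.2, h₄.1, h₄.2]

theorem intervalIntegral_zero_one_eq_add_reflect {g : ℝ → ℝ}
    (h₁ : IntervalIntegrable g volume 0 (1 / 2))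
    (h₂ : IntervalIntegrable (fun x => g (1 - x)) volume 0 (1 / 2)) :
    ∫ x in (0 : ℝ)..1, g x =
      (∫ x in (0 : ℝ)..(1 / 2), g x) + ∫ x in (0 : ℝ)..(1 / 2), g (1 - x) := by
  have h₃ : IntervalIntegrable g volume (1 / 2) 1 := by
    have := (h₂.comp_sub_left 1).symm
    norm_num at this
    simpa using this
  rw [intervalIntegral.integral_comp_sub_left,
    ← intervalIntegral.integral_add_adjacent_intervals h₁ h₃]
  norm_num

theorem integral_one_sub_rpow_mul_rpow {θ ρ : ℝ} (hθ : θ < 1) (hρ : ρ < 1) :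
    ∫ x in (0 : ℝ)..1, (1 - x) ^ (-θ) * x ^ (-ρ) = ProbabilityTheory.beta (1 - ρ) (1 - θ) := by
  rw [ProbabilityTheory.beta_eq_betaIntegralReal _ _ (by linarith) (by linarith),
    Complex.betaIntegral, ← Complex.ofReal_re (∫ x in (0 : ℝ)..1, _),
    ← intervalIntegral.integral_ofReal]
  congr 1
  refine intervalIntegral.integral_congr fun x hx => ?_
  rw [uIcc_of_le zero_le_one] at hx
  simp only [Complex.ofReal_mul]
  rw [Complex.ofReal_cpow (sub_nonneg.2 hx.2), Complex.ofReal_cpow hx.1, mul_comm]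
  push_cast
  congr 2 <;> ring

theorem tendsto_integral_convolution_div {r q : ℝ → ℝ} {θ ρ : ℝ} (hθ : θ < 1) (hρ : ρ < 1)
    (hrpos : ∀ t > 0, 0 < r t) (hqpos : ∀ t > 0, 0 < q t)
    (hranti : AntitoneOn r (Ioi 0)) (hqanti : AntitoneOn q (Ioi 0))
    (hrint : ∀ t > 0, IntegrableOn r (Ioc 0 t)) (hqint : ∀ t > 0, IntegrableOn q (Ioc 0 t))
    (hrrv : ∀ c > 0, Tendsto (fun t => r (c * t) / r t) atTop (𝓝 (c ^ (-θ))))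
    (hqrv : ∀ c > 0, Tendsto (fun t => q (c * t) / q t) atTop (𝓝 (c ^ (-ρ)))) :
    Tendsto (fun t => (∫ u in (0 : ℝ)..t, r (t - u) * q u) / (t * r t * q t)) atTop
      (𝓝 (ProbabilityTheory.beta (1 - ρ) (1 - θ))) := by
  have h₁ := tendsto_integral_half_div hρ hrpos hqpos hranti hqanti hqint hrrv hqrv
  have h₂ := tendsto_integral_half_div hθ hqpos hrpos hqanti hranti hrint hqrv hrrv
  have hlim := h₁.add h₂
  have hB : (∫ x in (0 : ℝ)..(1 / 2), (1 - x) ^ (-θ) * x ^ (-ρ)) +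
      (∫ x in (0 : ℝ)..(1 / 2), (1 - x) ^ (-ρ) * x ^ (-θ)) =
      ProbabilityTheory.beta (1 - ρ) (1 - θ) := by
    rw [← integral_one_sub_rpow_mul_rpow hθ hρ, intervalIntegral_zero_one_eq_add_reflect
      (intervalIntegrable_one_sub_rpow_mul_rpow_half hρ)]
    · simp only [sub_sub_cancel, mul_comm]
    · simpa only [sub_sub_cancel, mul_comm] using
        intervalIntegrable_one_sub_rpow_mul_rpow_half (θ := ρ) hθ
  rw [hB] at hlim
  refine hlim.congr' ?_
  filter_upwards [eventually_gt_atTop 0] with t ht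
  have hsubst : ∫ u in (0 : ℝ)..t, r (t - u) * q u =
      t * ∫ x in (0 : ℝ)..1, r ((1 - x) * t) * q (x * t) := by
    have := intervalIntegral.integral_comp_mul_right (a := 0) (b := 1)
      (fun u => r (t - u) * q u) ht.ne'
    simp only [zero_mul, one_mul, smul_eq_mul] at this
    simp only [sub_mul, one_mul]
    rw [this, mul_inv_cancel_left₀ ht.ne']
  rw [hsubst, intervalIntegral_zero_one_eq_add_reflect
    (intervalIntegrable_mul_comp_half ht hrpos hranti hqint)]
  · simp only [sub_sub_cancel, div_mul_div_comm, intervalIntegral.integral_div]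
    simp only [mul_comm (q ((1 - _) * t))]
    rw [mul_comm (q t), ← add_div, mul_assoc t, mul_div_mul_left _ _ ht.ne']
  · simpa only [sub_sub_cancel, mul_comm (r (_ * t))] using
      intervalIntegrable_mul_comp_half ht hqpos hqanti hrint

theorem tendsto_mul_mul_zero_of_one_lt_add {r q : ℝ → ℝ} {θ ρ : ℝ} (h : 1 < θ + ρ)
    (hrpos : ∀ t > 0, 0 < r t) (hqpos : ∀ t > 0, 0 < q t)
    (hranti : AntitoneOn r (Ioi 0)) (hqanti : AntitoneOn q (Ioi 0))
    (hrrv : ∀ c > 0, Tendsto (fun t => r (c * t) / r t) atTop (𝓝 (c ^ (-θ))))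
    (hqrv : ∀ c > 0, Tendsto (fun t => q (c * t) / q t) atTop (𝓝 (c ^ (-ρ)))) :
    Tendsto (fun t => t * r t * q t) atTop (𝓝 0) := by
  have hlim := ((hrrv 2 two_pos).mul (hqrv 2 two_pos)).const_mul 2
  have hlt : (2 : ℝ) * (2 ^ (-θ) * 2 ^ (-ρ)) < 1 := by
    rw [← Real.rpow_add two_pos, ← Real.rpow_one_add' zero_le_two (by linarith)]
    exact Real.rpow_lt_one_of_one_lt_of_neg one_lt_two (by linarith)
  obtain ⟨κ, hκ₁, hκ₂⟩ := exists_between hlt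
  obtain ⟨T, hT⟩ := eventually_atTop.1 (hlim.eventually (gt_mem_nhds hκ₁))
  have hS : 0 < max T 1 := by positivity
  refine tendsto_zero_of_half_le (M := 2 * max T 1 * r (max T 1) * q (max T 1)) hS
    (lt_trans (by positivity) hκ₁).le hκ₂ (fun t ht => ?_) (fun t ht => ?_) (fun t ht => ?_)
  · have := hrpos t ht
    have := hqpos t ht
    positivity
  · have htpos := hS.trans_le ht.1
    have := hrpos t htpos
    have := hqpos t htpos
    have := hrpos _ hS
    gcongr
    · exact ht.2
    · exact hranti hS htpos ht.1
    · exact hqanti hS htpos ht.1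
  · have hs : 0 < t / 2 := by linarith
    have h₁ := hT (t / 2) (by linarith [le_max_left T 1])
    rw [mul_div_cancel₀ t two_ne_zero] at h₁
    have hr := hrpos _ hs
    have hq := hqpos _ hs
    rw [div_mul_div_comm, ← mul_div_assoc, div_lt_iff₀ (by positivity)] at h₁
    nlinarith [mul_lt_mul_of_pos_left h₁ hs]

theorem tendsto_one_sub_exp_neg_div :
    Tendsto (fun x : ℝ => (1 - Real.exp (-x)) / x) (𝓝[≠] 0) (𝓝 1) := by
  have h : HasDerivAt (fun x : ℝ => 1 - Real.exp (-x)) 1 0 := by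
    simpa using ((hasDerivAt_neg (0 : ℝ)).exp).const_sub 1
  refine h.tendsto_slope.congr fun x => ?_
  simp [slope_def_field]

end


open Filter MeasureTheory Real in
theorem stmt6
    (θ ρ : ℝ) (hθpos : 0 < θ) (hρpos : 0 < ρ)
    (r q : ℝ → ℝ)
    (hrpos : ∀ t > (0:ℝ), 0 < r t) (hqpos : ∀ t > (0:ℝ), 0 < q t)
    (hranti : AntitoneOn r (Set.Ioi 0)) (hqanti : AntitoneOn q (Set.Ioi 0))
    (hrint : ∀ t > (0:ℝ), MeasureTheory.IntegrableOn r (Set.Ioc 0 t))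
    (hqint : ∀ t > (0:ℝ), MeasureTheory.IntegrableOn q (Set.Ioc 0 t))
    (hrrv : ∀ c > (0:ℝ), Filter.Tendsto (fun t => r (c * t) / r t) Filter.atTop (nhds (c ^ (-θ))))
    (hqrv : ∀ c > (0:ℝ), Filter.Tendsto (fun t => q (c * t) / q t) Filter.atTop (nhds (c ^ (-ρ))))
    (R Q I P : ℝ → ℝ)
    (hR : ∀ t, R t = ∫ u in (0:ℝ)..t, r u)
    (hQ : ∀ t, Q t = ∫ u in (0:ℝ)..t, q u)
    (hI : ∀ t, I t = ∫ u in (0:ℝ)..t, r (t - u) * q u)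
    (hP : ∀ t, P t = 1 - Real.exp (-(I t)))
    (hθ : θ < 1) (hρ : ρ < 1)
    (hcase : 1 < θ + ρ ∨ (θ + ρ = 1 ∧
      Filter.Tendsto (fun t => t * r t * q t) Filter.atTop (nhds 0))) :
    Filter.Tendsto
      (fun t => I t / (t * r t * q t *
        (Real.Gamma (1 - ρ) * Real.Gamma (1 - θ) / Real.Gamma ((1 - ρ) + (1 - θ)))))
      Filter.atTop (nhds 1)
    ∧ Filter.Tendsto I Filter.atTop (nhds 0)
    ∧ Filter.Tendsto
      (fun t => P t / (t * r t * q t *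
        (Real.Gamma (1 - ρ) * Real.Gamma (1 - θ) / Real.Gamma ((1 - ρ) + (1 - θ)))))
      Filter.atTop (nhds 1) := by
  have hB : Real.Gamma (1 - ρ) * Real.Gamma (1 - θ) / Real.Gamma ((1 - ρ) + (1 - θ)) =
      ProbabilityTheory.beta (1 - ρ) (1 - θ) := rfl
  have hBpos : 0 < ProbabilityTheory.beta (1 - ρ) (1 - θ) :=
    ProbabilityTheory.beta_pos (by linarith) (by linarith)
  simp only [hB]
  have hdiv : Tendsto (fun t => I t / (t * r t * q t)) atTop
      (nhds (ProbabilityTheory.beta (1 - ρ) (1 - θ))) := by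
    simpa only [hI] using
      tendsto_integral_convolution_div hθ hρ hrpos hqpos hranti hqanti hrint hqint hrrv hqrv
  have hzero : Tendsto (fun t => t * r t * q t) atTop (nhds 0) := by
    rcases hcase with h | h
    · exact tendsto_mul_mul_zero_of_one_lt_add h hrpos hqpos hranti hqanti hrrv hqrv
    · exact h.2
  have hpos : ∀ t > (0 : ℝ), 0 < t * r t * q t := fun t ht =>
    mul_pos (mul_pos ht (hrpos t ht)) (hqpos t ht)
  have hI₀ : Tendsto I atTop (nhds 0) := by
    have h := hdiv.mul hzero
    rw [mul_zero] at h
    refine h.congr' ?_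
    filter_upwards [eventually_gt_atTop 0] with t ht
    exact div_mul_cancel₀ _ (hpos t ht).ne'
  have hone : Tendsto (fun t => I t / (t * r t * q t * ProbabilityTheory.beta (1 - ρ) (1 - θ)))
      atTop (nhds 1) := by
    have h := hdiv.div_const (ProbabilityTheory.beta (1 - ρ) (1 - θ))
    rw [div_self hBpos.ne'] at h
    simpa only [div_div] using h
  have hI_ne : ∀ᶠ t in atTop, I t ≠ 0 := by
    filter_upwards [hone.eventually_ne one_ne_zero] with t ht h
    simp [h] at ht
  refine ⟨hone, hI₀, ?_⟩
  have h := (tendsto_one_sub_exp_neg_div.comp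
    (tendsto_nhdsWithin_iff.2 ⟨hI₀, hI_ne⟩)).mul hone
  rw [one_mul] at h
  refine h.congr' ?_
  filter_upwards [hI_ne] with t ht
  rw [Function.comp_apply, ← hP, div_mul_div_cancel₀ ht]
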